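/- arXiv:1207.4834 — 4 statements merged into one kernel-verified Lean document; each statement's English description precedes it below -/
import Mathlib

section
/- Let n ≥ 1, d > 0, and 0 < ε ≤ 1/2. Let Φ : ℝⁿ → ℝⁿ (ℝⁿ = EuclideanSpace ℝ (Fin n)) satisfy ‖Φ ξ − Φ ζ − (ξ − ζ)‖ ≤ ε·‖ξ − ζ‖ for all ξ, ζ in the closed ball B̄_d of radius d centered at 0. Then: (a) the image Φ '' B̄_d contains the closed ball of radius d/2 centered at Φ 0; (b) Φ is injective on B̄_d; and (c) for all ξ, ζ ∈ B̄_d, (1/2)·‖ξ − ζ‖ ≤ ‖Φ ξ − Φ ζ‖ ≤ 2·‖ξ − ζ‖ (so the inverse of Φ on Φ '' B̄_d is Lipschitz with constant 2). -/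
/-- Standard form of the paper's Lemma 2.3: an almost-identity perturbation `Φ` on the closed
ball of radius `d` (deviating from the identity by at most `ε ≤ 1/2` times the increment)
covers the ball of radius `d/2` around `Φ 0`, is injective on the ball, and is bi-Lipschitz
with constants `1/2` and `2`. -/
theorem almost_identity_covering_lemma (n : ℕ) (hn : 1 ≤ n) (d ε : ℝ)
    (hd : 0 < d) (hε : 0 < ε) (hε' : ε ≤ 1 / 2)
    (Φ : EuclideanSpace ℝ (Fin n) → EuclideanSpace ℝ (Fin n))
    (hΦ : ∀ ξ ∈ Metric.closedBall (0 : EuclideanSpace ℝ (Fin n)) d,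
          ∀ ζ ∈ Metric.closedBall (0 : EuclideanSpace ℝ (Fin n)) d,
          ‖Φ ξ - Φ ζ - (ξ - ζ)‖ ≤ ε * ‖ξ - ζ‖) :
    Metric.closedBall (Φ 0) (d / 2) ⊆ Φ '' Metric.closedBall 0 d ∧
    Set.InjOn Φ (Metric.closedBall 0 d) ∧
    (∀ ξ ∈ Metric.closedBall (0 : EuclideanSpace ℝ (Fin n)) d,
     ∀ ζ ∈ Metric.closedBall (0 : EuclideanSpace ℝ (Fin n)) d,
       (1 / 2) * ‖ξ - ζ‖ ≤ ‖Φ ξ - Φ ζ‖ ∧ ‖Φ ξ - Φ ζ‖ ≤ 2 * ‖ξ - ζ‖) := by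
  have bilipschitz : ∀ ξ ∈ Metric.closedBall (0 : EuclideanSpace ℝ (Fin n)) d,
      ∀ ζ ∈ Metric.closedBall (0 : EuclideanSpace ℝ (Fin n)) d,
        (1 / 2) * ‖ξ - ζ‖ ≤ ‖Φ ξ - Φ ζ‖ ∧ ‖Φ ξ - Φ ζ‖ ≤ 2 * ‖ξ - ζ‖ := by
    intro ξ hξ ζ hζ
    have h := abs_le.1 ((abs_norm_sub_norm_le _ _).trans (hΦ ξ hξ ζ hζ))
    have hle := mul_le_mul_of_nonneg_right hε' (norm_nonneg (ξ - ζ))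
    have hnn := norm_nonneg (ξ - ζ)
    constructor <;> linarith [h.1, h.2]
  refine ⟨?_, fun ξ hξ ζ hζ h => ?_, bilipschitz⟩
  · have happrox : ApproximatesLinearOn Φ (ContinuousLinearMap.id ℝ _)
        (Metric.closedBall 0 d) ⟨ε, hε.le⟩ := hΦ
    let idRightInverse : (ContinuousLinearMap.id ℝ
        (EuclideanSpace ℝ (Fin n))).NonlinearRightInverse :=
      { toFun := id
        nnnorm := 1
        bound' := fun y => by simp
        right_inv' := fun y => rfl }
    refine (Metric.closedBall_subset_closedBall ?_).trans
      (happrox.surjOn_closedBall_of_nonlinearRightInverse idRightInverse hd.le subset_rfl)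
    change d / 2 ≤ (((1 : NNReal) : ℝ)⁻¹ - ε) * d
    rw [NNReal.coe_one, inv_one]
    nlinarith
  · have hle := (bilipschitz ξ hξ ζ hζ).1
    rw [h, sub_self, norm_zero] at hle
    exact sub_eq_zero.1 (norm_le_zero_iff.1 (by linarith))
end

section
/- Let n ≥ 1 and c, d > 0. Let Q, ν, Φ : ℝⁿ → ℝⁿ (ℝⁿ = EuclideanSpace ℝ (Fin n)) satisfy: (i) Q is injective on the closed ball B̄_d of radius d centered at 0, and for every ξ and every r > 0 with ‖ξ‖ + r ≤ d, the image Q '' (closedBall ξ r) contains the closed ball of radius c·r² centered at Q ξ; (ii) ν is continuous, ‖ν λ‖ ≤ (1/2)·‖λ‖ for all λ with ‖λ‖ ≤ c·d², and ‖ν λ‖ < ‖λ‖ for all λ ≠ 0; (iii) Φ ξ − Φ ζ = (Q ξ − Q ζ) + ν (Q ξ − Q ζ) for all ξ, ζ ∈ B̄_d. Then Φ is injective on B̄_d and the image Φ '' B̄_d contains the closed ball of radius c·d²/2 centered at Φ 0. -/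
/-- A map that respects differences of points of a closed ball and halves norms there is
`1/2`-Lipschitz on that ball. -/
theorem norm_sub_le_half_of_map_sub {E : Type*} [NormedAddCommGroup E] [NormedSpace ℝ E]
    {ν : E → E} {R : ℝ} (hsub : ∀ u v : E, ‖u‖ ≤ R → ‖v‖ ≤ R → ν (u - v) = ν u - ν v)
    (hν : ∀ u : E, ‖u‖ ≤ R → ‖ν u‖ ≤ (1 / 2) * ‖u‖) {u v : E} (hu : ‖u‖ ≤ R) (hv : ‖v‖ ≤ R) :
    ‖ν u - ν v‖ ≤ (1 / 2) * ‖u - v‖ := by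
  set m : E := (1 / 2 : ℝ) • (u + v) with hm
  set h : E := (1 / 2 : ℝ) • (u - v) with hh
  have hmR : ‖m‖ ≤ R := by
    rw [hm, norm_smul, Real.norm_of_nonneg (by norm_num)]
    linarith [norm_add_le u v]
  have hh_norm : ‖h‖ = (1 / 2) * ‖u - v‖ := by
    rw [hh, norm_smul, Real.norm_of_nonneg (by norm_num)]
  have hhR : ‖h‖ ≤ R := by linarith [norm_sub_le u v]
  have hum : u - m = h := by rw [hm, hh]; module
  have hmv : m - v = h := by rw [hm, hh]; module
  have h₁ := hsub u m hu hmR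
  have h₂ := hsub m v hmR hv
  rw [hum] at h₁
  rw [hmv] at h₂
  have hsum : ν u - ν v = ν h + ν h := by nth_rewrite 1 [h₁]; rw [h₂]; abel
  rw [hsum]
  linarith [norm_add_le (ν h) (ν h), hν h hhR]

/-- The perturbation of the identity by a map as in `norm_sub_le_half_of_map_sub` covers the
closed ball of half the radius. -/
theorem exists_add_map_eq_of_map_sub {E : Type*} [NormedAddCommGroup E] [NormedSpace ℝ E]
    [CompleteSpace E] {ν : E → E} {R : ℝ} (hR : 0 ≤ R)
    (hsub : ∀ u v : E, ‖u‖ ≤ R → ‖v‖ ≤ R → ν (u - v) = ν u - ν v)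
    (hν : ∀ u : E, ‖u‖ ≤ R → ‖ν u‖ ≤ (1 / 2) * ‖u‖) {η : E} (hη : ‖η‖ ≤ R / 2) :
    ∃ u : E, ‖u‖ ≤ R ∧ u + ν u = η := by
  have hmaps : Set.MapsTo (fun u => η - ν u) (Metric.closedBall (0 : E) R)
      (Metric.closedBall 0 R) := by
    intro u hu
    rw [mem_closedBall_zero_iff] at hu ⊢
    linarith [norm_sub_le η (ν u), hν u hu]
  have hcontr : ContractingWith (1 / 2) hmaps.restrict := by
    refine ⟨by rw [← NNReal.coe_lt_coe]; norm_num, LipschitzWith.of_dist_le_mul ?_⟩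
    rintro ⟨u, hu⟩ ⟨v, hv⟩
    rw [mem_closedBall_zero_iff] at hu hv
    have h := norm_sub_le_half_of_map_sub hsub hν hu hv
    simpa [Subtype.dist_eq, dist_eq_norm, norm_sub_rev] using h
  obtain ⟨u, hu, hfix, -⟩ := hcontr.exists_fixedPoint' Metric.isClosed_closedBall.isComplete hmaps
    (Metric.mem_closedBall_self hR) (edist_ne_top _ _)
  refine ⟨u, mem_closedBall_zero_iff.1 hu, ?_⟩
  have hfix' : η - ν u = u := hfix
  rw [← sub_eq_iff_eq_add.1 hfix']

/-- Standard form of the paper's Lemma 3.5: a perturbation `Φ` of a quadratically regular,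
injective map `Q`, whose difference map differs from that of `Q` by `ν` applied to it with
`ν` small, remains injective on the closed `d`-ball and covers the closed ball of radius
`c·d²/2` around `Φ 0`. -/
theorem quadratic_perturbation_lemma (n : ℕ) (hn : 1 ≤ n) (c d : ℝ)
    (hc : 0 < c) (hd : 0 < d)
    (Q ν Φ : EuclideanSpace ℝ (Fin n) → EuclideanSpace ℝ (Fin n))
    (hQinj : Set.InjOn Q (Metric.closedBall 0 d))
    (hQreg : ∀ ξ : EuclideanSpace ℝ (Fin n), ∀ r : ℝ, 0 < r → ‖ξ‖ + r ≤ d →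
      Metric.closedBall (Q ξ) (c * r ^ 2) ⊆ Q '' Metric.closedBall ξ r)
    (hνcont : Continuous ν)
    (hν₁ : ∀ lam : EuclideanSpace ℝ (Fin n), ‖lam‖ ≤ c * d ^ 2 →
      ‖ν lam‖ ≤ (1 / 2) * ‖lam‖)
    (hν₂ : ∀ lam : EuclideanSpace ℝ (Fin n), lam ≠ 0 → ‖ν lam‖ < ‖lam‖)
    (hΦ : ∀ ξ ∈ Metric.closedBall (0 : EuclideanSpace ℝ (Fin n)) d,
          ∀ ζ ∈ Metric.closedBall (0 : EuclideanSpace ℝ (Fin n)) d,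
          Φ ξ - Φ ζ = (Q ξ - Q ζ) + ν (Q ξ - Q ζ)) :
    Set.InjOn Φ (Metric.closedBall 0 d) ∧
    Metric.closedBall (Φ 0) (c * d ^ 2 / 2) ⊆ Φ '' Metric.closedBall 0 d := by
  have h0 : (0 : EuclideanSpace ℝ (Fin n)) ∈ Metric.closedBall 0 d :=
    Metric.mem_closedBall_self hd.le
  refine ⟨fun ξ hξ ζ hζ hEq => hQinj hξ hζ ?_, fun y hy => ?_⟩
  · by_contra hne
    have h := hΦ ξ hξ ζ hζ
    rw [hEq, sub_self] at h
    have hlt := hν₂ _ (sub_ne_zero.2 hne)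
    rw [eq_neg_of_add_eq_zero_right h.symm, norm_neg] at hlt
    exact lt_irrefl _ hlt
  have hlift : ∀ u : EuclideanSpace ℝ (Fin n), ‖u‖ ≤ c * d ^ 2 →
      ∃ ξ ∈ Metric.closedBall (0 : EuclideanSpace ℝ (Fin n)) d, Q ξ - Q 0 = u := by
    intro u hu
    obtain ⟨ξ, hξ, hQξ⟩ := hQreg 0 d hd (by simp)
      (show Q 0 + u ∈ Metric.closedBall (Q 0) (c * d ^ 2) by simpa using hu)
    exact ⟨ξ, hξ, by rw [hQξ, add_sub_cancel_left]⟩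
  have hsub : ∀ u v : EuclideanSpace ℝ (Fin n), ‖u‖ ≤ c * d ^ 2 → ‖v‖ ≤ c * d ^ 2 →
      ν (u - v) = ν u - ν v := by
    intro u v hu hv
    obtain ⟨ξ, hξ, rfl⟩ := hlift u hu
    obtain ⟨ζ, hζ, rfl⟩ := hlift v hv
    have h₁ := hΦ ξ hξ ζ hζ
    have h₂ := hΦ ξ hξ 0 h0
    have h₃ := hΦ ζ hζ 0 h0
    rw [sub_sub_sub_cancel_right, ← sub_eq_iff_eq_add'.2 h₁, ← sub_eq_iff_eq_add'.2 h₂,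
      ← sub_eq_iff_eq_add'.2 h₃]
    abel
  obtain ⟨u, hu, hsol⟩ := exists_add_map_eq_of_map_sub (by positivity) hsub hν₁
    (mem_closedBall_iff_norm.1 hy)
  obtain ⟨ξ, hξ, rfl⟩ := hlift u hu
  refine ⟨ξ, hξ, ?_⟩
  rw [← hΦ ξ hξ 0 h0] at hsol
  exact sub_left_injective hsol
end

section
/- Let m, n ≥ 1 and let Φ : (Fin m → ℝ*) → (Fin n → ℝ*) be a map on hyperreal vectors that maps finite vectors to finite vectors. Then Φ is almost linear if and only if there exists an ℝ-linear map T : (Fin m → ℝ) → (Fin n → ℝ) such that for every finite vector v and every index i, the hyperreal Φ v i − ((T (fun j => st (v j))) i : ℝ*) is infinitesimal (where the real number is coerced into ℝ*). -/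
/-- A vector of hyperreals is finite if every component is finite (not infinite). -/
def HyperVecFinite {m : ℕ} (v : Fin m → ℝ*) : Prop :=
  ∀ i, ¬ Hyperreal.Infinite (v i)

/-- A map on hyperreal vectors is almost linear if it respects linear combinations with
finite scalar coefficients of finite vectors up to infinitesimals, componentwise. -/
def HyperAlmostLinear {m n : ℕ} (Φ : (Fin m → ℝ*) → (Fin n → ℝ*)) : Prop :=
  ∀ α β : ℝ*, ¬ Hyperreal.Infinite α → ¬ Hyperreal.Infinite β →
    ∀ v w : Fin m → ℝ*, HyperVecFinite v → HyperVecFinite w →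
      ∀ i, Hyperreal.Infinitesimal
        (Φ (α • v + β • w) i - (α • Φ v + β • Φ w) i)

set_option linter.deprecated false

namespace Hyperreal

theorem isSt_iff_infinitesimal_sub {x : ℝ*} {r : ℝ} : IsSt x r ↔ Infinitesimal (x - r) :=
  ⟨IsSt.infinitesimal_sub, fun h => by
    simpa using IsSt.add h (isSt_refl_real r)⟩

theorem Infinitesimal.isSt_of_sub {x y : ℝ*} {r : ℝ} (h : Infinitesimal (x - y))
    (hy : IsSt y r) : IsSt x r := by
  simpa using IsSt.add h hy

theorem IsSt.infinitesimal_sub_of_isSt {x y : ℝ*} {r : ℝ} (hx : IsSt x r) (hy : IsSt y r) :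
    Infinitesimal (x - y) := by
  simpa [Infinitesimal] using hx.sub hy

end Hyperreal

open Hyperreal

theorem HyperVecFinite.zero {m : ℕ} : HyperVecFinite (0 : Fin m → ℝ*) :=
  fun _ => not_infinite_zero

theorem HyperVecFinite.add {m : ℕ} {v w : Fin m → ℝ*} (hv : HyperVecFinite v)
    (hw : HyperVecFinite w) : HyperVecFinite (v + w) :=
  fun i => not_infinite_add (hv i) (hw i)

theorem HyperVecFinite.smul {m : ℕ} {α : ℝ*} {v : Fin m → ℝ*} (hα : ¬ Infinite α)
    (hv : HyperVecFinite v) : HyperVecFinite (α • v) :=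
  fun i => not_infinite_mul hα (hv i)

theorem HyperVecFinite.sum {m : ℕ} {ι : Type*} {s : Finset ι} {v : ι → Fin m → ℝ*}
    (hv : ∀ j ∈ s, HyperVecFinite (v j)) : HyperVecFinite (∑ j ∈ s, v j) :=
  Finset.sum_induction v HyperVecFinite (fun _ _ => HyperVecFinite.add) HyperVecFinite.zero hv

theorem HyperVecFinite.single_one {m : ℕ} (j : Fin m) :
    HyperVecFinite (Pi.single j 1 : Fin m → ℝ*) := by
  intro i
  rcases eq_or_ne i j with rfl | h
  · simpa using not_infinite_real 1
  · simpa [h] using not_infinite_zero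

theorem HyperAlmostLinear.isSt_sum {m n : ℕ} {Φ : (Fin m → ℝ*) → (Fin n → ℝ*)}
    (hΦ : HyperAlmostLinear Φ) (hfin : ∀ v, HyperVecFinite v → HyperVecFinite (Φ v))
    {ι : Type*} (s : Finset ι) {c : ι → ℝ*} {v : ι → Fin m → ℝ*}
    (hc : ∀ j, ¬ Infinite (c j)) (hv : ∀ j, HyperVecFinite (v j)) (i : Fin n) :
    IsSt (Φ (∑ j ∈ s, c j • v j) i) (∑ j ∈ s, st (c j) * st (Φ (v j) i)) := by
  classical
  induction s using Finset.induction_on with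
  | empty =>
    have h := hΦ 0 0 not_infinite_zero not_infinite_zero 0 0 .zero .zero i
    simpa [Infinitesimal] using h
  | insert a s ha ih =>
    have h1 : ¬ Infinite (1 : ℝ*) := by simpa using not_infinite_real 1
    have h := hΦ (c a) 1 (hc a) h1 (v a) (∑ j ∈ s, c j • v j) (hv a)
      (.sum fun j _ => (hv j).smul (hc j)) i
    rw [Finset.sum_insert ha, Finset.sum_insert ha]
    rw [one_smul, one_smul] at h
    exact h.isSt_of_sub (((isSt_st' (hc a)).mul (isSt_st' (hfin _ (hv a) i))).add ih)

/-- Part (ii) of Lemma 1.2: a map on hyperreal vectors sending finite vectors to finite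
vectors is almost linear iff it has a linear shadow `T` with `st ∘ Φ = T ∘ st` on finite
vectors, i.e. `Φ v i` differs from `T (st ∘ v) i` by an infinitesimal. -/
theorem almost_linear_iff_linear_shadow (m n : ℕ) (hm : 1 ≤ m) (hn : 1 ≤ n)
    (Φ : (Fin m → ℝ*) → (Fin n → ℝ*))
    (hfin : ∀ v : Fin m → ℝ*, HyperVecFinite v → HyperVecFinite (Φ v)) :
    HyperAlmostLinear Φ ↔
      ∃ T : (Fin m → ℝ) →ₗ[ℝ] (Fin n → ℝ),
        ∀ v : Fin m → ℝ*, HyperVecFinite v →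
          ∀ i, Hyperreal.Infinitesimal
            (Φ v i - ((T (fun j => Hyperreal.st (v j))) i : ℝ*)) := by
  simp only [← isSt_iff_infinitesimal_sub]
  constructor
  · intro hΦ
    refine ⟨Matrix.toLin' (.of fun i j => st (Φ (Pi.single j 1) i)), fun v hv i => ?_⟩
    have h := hΦ.isSt_sum hfin Finset.univ hv HyperVecFinite.single_one i
    rw [← pi_eq_sum_univ' v] at h
    simpa [Matrix.mulVec, dotProduct, mul_comm] using h
  · rintro ⟨T, hT⟩ α β hα hβ v w hv hw i
    have hst : (fun j => st ((α • v + β • w) j)) =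
        st α • (fun j => st (v j)) + st β • (fun j => st (w j)) := by
      funext j
      exact (((isSt_st' hα).mul (isSt_st' (hv j))).add
        ((isSt_st' hβ).mul (isSt_st' (hw j)))).st_eq
    have h := hT _ ((hv.smul hα).add (hw.smul hβ)) i
    rw [hst, map_add, map_smul, map_smul] at h
    exact h.infinitesimal_sub_of_isSt
      (((isSt_st' hα).mul (hT v hv i)).add ((isSt_st' hβ).mul (hT w hw i)))
end

section
/- Let n ≥ 1. For every d with 0 < d ≤ 1 and every r with 0 < r < d, there exists c > 0 such that: for all v, w : Fin n → ℝ with ‖v‖ + r ≤ d, if the Frobenius norm ‖Matrix.vecMulVec w w − Matrix.vecMulVec v v‖ < c·r², then there exists u : Fin n → ℝ with ‖u − v‖ < r and Matrix.vecMulVec u u = Matrix.vecMulVec w w. (Here ‖·‖ on vectors is the Euclidean norm.) -/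
attribute [local instance] Matrix.frobeniusNormedAddCommGroup

/-- The squared Frobenius norm of a real matrix is the sum of the squares of its entries. -/
theorem Matrix.frobenius_norm_sq_eq_sum {m n : Type*} [Fintype m] [Fintype n]
    (A : Matrix m n ℝ) : ‖A‖ ^ 2 = ∑ i, ∑ j, A i j ^ 2 := by
  have h : 0 ≤ ∑ i, ∑ j, ‖A i j‖ ^ (2 : ℝ) := by positivity
  rw [Matrix.frobenius_norm_def, ← Real.sqrt_eq_rpow, Real.sq_sqrt h]
  simp

theorem Matrix.frobenius_norm_sq_vecMulVec_sub {n : Type*} [Fintype n] (v w : n → ℝ) :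
    ‖Matrix.vecMulVec w w - Matrix.vecMulVec v v‖ ^ 2 =
      (w ⬝ᵥ w) ^ 2 + (v ⬝ᵥ v) ^ 2 - 2 * (v ⬝ᵥ w) ^ 2 := by
  rw [Matrix.frobenius_norm_sq_eq_sum]
  simp only [dotProduct, sq, Finset.sum_mul_sum]
  simp only [Finset.mul_sum, ← Finset.sum_add_distrib, ← Finset.sum_sub_distrib,
    Matrix.sub_apply, Matrix.vecMulVec_apply]
  refine Finset.sum_congr rfl fun i _ => Finset.sum_congr rfl fun j _ => ?_
  ring

/-- If `v` and `w` form a non-obtuse angle, then `‖w - v‖ ^ 2 ≤ √2 * ‖w wᵀ - v vᵀ‖`. -/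
theorem Matrix.sq_dotProduct_sub_le_frobenius_norm_sq {n : Type*} [Fintype n] {v w : n → ℝ}
    (h : 0 ≤ v ⬝ᵥ w) :
    ((w - v) ⬝ᵥ (w - v)) ^ 2 ≤
      2 * ‖Matrix.vecMulVec w w - Matrix.vecMulVec v v‖ ^ 2 := by
  have hexp : (w - v) ⬝ᵥ (w - v) = w ⬝ᵥ w + v ⬝ᵥ v - 2 * (v ⬝ᵥ w) := by
    rw [sub_dotProduct, dotProduct_sub, dotProduct_sub, dotProduct_comm w v]
    ring
  have hnonneg : 0 ≤ (w - v) ⬝ᵥ (w - v) := by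
    simpa using dotProduct_star_self_nonneg (w - v)
  rw [Matrix.frobenius_norm_sq_vecMulVec_sub, hexp]
  rw [hexp] at hnonneg
  nlinarith [sq_nonneg (w ⬝ᵥ w - v ⬝ᵥ v), mul_nonneg h hnonneg]

theorem norm_sub_lt_of_frobenius_norm_vecMulVec_sub_lt {n : Type*} [Fintype n] {v w : n → ℝ}
    {r : ℝ} (hr : 0 < r) (h : 0 ≤ v ⬝ᵥ w)
    (hvw : ‖Matrix.vecMulVec w w - Matrix.vecMulVec v v‖ < 1 / 2 * r ^ 2) :
    ‖(WithLp.equiv 2 (n → ℝ)).symm (w - v)‖ < r := by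
  have hsq : ‖(WithLp.equiv 2 (n → ℝ)).symm (w - v)‖ ^ 2 = (w - v) ⬝ᵥ (w - v) := by
    rw [EuclideanSpace.norm_sq_eq]
    simp [dotProduct, sq]
  refine lt_of_pow_lt_pow_left₀ 2 hr.le ?_
  rw [hsq]
  refine lt_of_pow_lt_pow_left₀ 2 (sq_nonneg r) ?_
  have hF := pow_lt_pow_left₀ hvw (norm_nonneg _) two_ne_zero
  nlinarith [Matrix.sq_dotProduct_sub_le_frobenius_norm_sq h, sq_nonneg (r ^ 2)]

/-- Quantitative local covering claim of Lemma 3.8: the symmetric-square map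
`p₂ : v ↦ v vᵀ` is quadratically regular onto its image: for `0 < d ≤ 1` and `0 < r < d`
there is `c > 0` such that any point `w wᵀ` of the image within Frobenius distance `c·r²`
of `v vᵀ` (with `‖v‖ + r ≤ d` in the Euclidean norm) is the image `u uᵀ` of some `u` with
`‖u − v‖ < r`. -/
theorem symmetric_square_quadratic_covering (n : ℕ) (hn : 1 ≤ n) :
    ∀ d : ℝ, 0 < d → d ≤ 1 → ∀ r : ℝ, 0 < r → r < d →
      ∃ c : ℝ, 0 < c ∧
        ∀ v w : Fin n → ℝ,
          ‖(WithLp.equiv 2 (Fin n → ℝ)).symm v‖ + r ≤ d →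
          ‖Matrix.vecMulVec w w - Matrix.vecMulVec v v‖ < c * r ^ 2 →
          ∃ u : Fin n → ℝ,
            ‖(WithLp.equiv 2 (Fin n → ℝ)).symm (u - v)‖ < r ∧
            Matrix.vecMulVec u u = Matrix.vecMulVec w w := by
  intro d _ _ r hr _
  refine ⟨1 / 2, by norm_num, fun v w _ hvw => ?_⟩
  rcases le_total 0 (v ⬝ᵥ w) with h | h
  · exact ⟨w, norm_sub_lt_of_frobenius_norm_vecMulVec_sub_lt hr h hvw, rfl⟩
  · have hneg : Matrix.vecMulVec (-w) (-w) = Matrix.vecMulVec w w := by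
      rw [Matrix.neg_vecMulVec, Matrix.vecMulVec_neg, neg_neg]
    refine ⟨-w, norm_sub_lt_of_frobenius_norm_vecMulVec_sub_lt hr ?_ (hneg ▸ hvw), hneg⟩
    simpa using h
end
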